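/- Key decomposition of CMPL's (type 1/2/3 decomposition): let (𝛆;𝔰) be a positive array of depth n with Init(𝔰) = (s₁,…,s_{k−1}) for some 1 ≤ k ≤ n (so s_j ≤ q for all j < k and s_k > q), and let ε ∈ Γ_N. Then there exist finitely many coefficients b_i, c_i ∈ A_N, each divisible by D₁ = θ^q − θ, and positive arrays (𝛜'_i;𝔱'_i) and (𝛍_i;𝔲_i), all of weight w(𝔰), such that Li(𝛆;𝔰) = −Li(𝛆';𝔰') + Σ_i b_i·Li(𝛜'_i;𝔱'_i) + Σ_i c_i·Li(𝛍_i;𝔲_i), where: 𝔰' = (s₁,…,s_{k−1}, q, s_k−q, s_{k+1},…,s_n) and 𝛆' = (ε₁,…,ε_{k−1}, ε, ε^{−1}ε_k, ε_{k+1},…,ε_n); every tuple 𝔱 appearing on the right-hand side has depth(𝔱) ≥ n and satisfies T_k(𝔱) ≤ T_k(𝔰); moreover s'₁+⋯+s'_ℓ < s₁+⋯+s_ℓ and t'_{i,1}+⋯+t'_{i,ℓ} < s₁+⋯+s_ℓ for all k ≤ ℓ ≤ n; and Init(𝔰) ≺ Init(𝔲_i) for every i. -/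

import Mathlib

noncomputable section

open scoped Classical

namespace ZHPC

variable (Fq : Type) [Field Fq] [Fintype Fq]

/-- `q`, the cardinality of the base finite field `𝔽_q`. -/
def qc : ℕ := Fintype.card Fq

/-- A fixed algebraic closure `𝔽̄_q` of `𝔽_q`. -/
abbrev Fb := AlgebraicClosure Fq

/-- The field `𝔽̄_q((1/θ))` of formal Laurent series in `1/θ` over `𝔽̄_q`, modeled as the
field of formal Laurent series in one variable, `θ` being the inverse of that variable. -/
abbrev Kinf := LaurentSeries (Fb Fq)

/-- The embedding of the constants `𝔽̄_q → 𝔽̄_q((1/θ))`. -/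
def cst : Fb Fq →+* Kinf Fq := HahnSeries.C

/-- The element `θ`. -/
def theta : Kinf Fq := HahnSeries.single (-1 : ℤ) 1

/-- `ℓ_d = ∏_{i=1}^{d} (θ - θ^{q^i})`, with `ℓ_0 = 1`. -/
def ell (d : ℕ) : Kinf Fq := ∏ i ∈ Finset.Icc 1 d, (theta Fq - theta Fq ^ qc Fq ^ i)

/-- Arrays `(𝛆;𝔰)` of some depth `n`. -/
structure PArr (F : Type) where
  depth : ℕ
  s : Fin depth → ℕ
  eps : Fin depth → F

namespace PArr

variable {F : Type}

/-- A *positive array* for level `N`: all entries `sᵢ` are positive integers and all the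
characters `εᵢ` are `N`-th roots of unity. -/
def Positive [Monoid F] (N : ℕ) (A : PArr F) : Prop := (∀ i, 0 < A.s i) ∧ ∀ i, A.eps i ^ N = 1

/-- The weight `w(𝔰) = s₁ + ⋯ + s_n`. -/
def wt (A : PArr F) : ℕ := ∑ i, A.s i

/-- The `i`-th entry of `𝔰` (`0`-indexed), with value `0` beyond the depth. -/
def sAt (A : PArr F) (i : ℕ) : ℕ := if h : i < A.depth then A.s ⟨i, h⟩ else 0

/-- The partial sums `s₁ + ⋯ + s_i` (entries beyond the depth being `0`). -/
def psum (A : PArr F) (i : ℕ) : ℕ := ∑ j ∈ Finset.range i, A.sAt j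

/-- The character `χ(𝛆) = ε₁ ⋯ ε_n`. -/
def chi [CommMonoid F] (A : PArr F) : F := ∏ i, A.eps i

end PArr

/-- The Carlitz multiple polylogarithm at roots of unity
`Li(𝛆;𝔰) = Σ_{d₁ > ⋯ > d_n ≥ 0} ε₁^{d₁}⋯ε_n^{d_n} / (ℓ_{d₁}^{s₁}⋯ℓ_{d_n}^{s_n})`. -/
def Li (A : PArr (Fb Fq)) : Kinf Fq :=
  ∑' d : {f : Fin A.depth → ℕ // StrictAnti f},
    ∏ i, cst Fq (A.eps i ^ d.1 i) / ell Fq (d.1 i) ^ A.s i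

/-- `Si_d(𝛆;𝔰)`: same summand as `Li`, over decreasing tuples with `d₁ = d`. -/
def Sid (d : ℤ) (A : PArr (Fb Fq)) : Kinf Fq :=
  ∑' f : {f : Fin A.depth → ℕ // StrictAnti f ∧ ∀ i : Fin A.depth, i.val = 0 → (f i : ℤ) = d},
    ∏ i, cst Fq (A.eps i ^ f.1 i) / ell Fq (f.1 i) ^ A.s i

/-- `Si_{<d}(𝛆;𝔰)`: same summand as `Li`, over decreasing tuples with `d > d₁`. -/
def SidLt (d : ℤ) (A : PArr (Fb Fq)) : Kinf Fq :=
  ∑' f : {f : Fin A.depth → ℕ // StrictAnti f ∧ ∀ i : Fin A.depth, (f i : ℤ) < d},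
    ∏ i, cst Fq (A.eps i ^ f.1 i) / ell Fq (f.1 i) ^ A.s i

/-- The value at `θ` of the monic polynomial `θ^e + Σ_{j<e} c_j θ^j ∈ A = 𝔽_q[θ]`. -/
def monicVal (e : ℕ) (c : Fin e → Fq) : Kinf Fq :=
  theta Fq ^ e + ∑ j, cst Fq (algebraMap Fq (Fb Fq) (c j)) * theta Fq ^ (j : ℕ)

/-- The power sum `S_d(𝛆;𝔰)`, a sum over tuples of monic polynomials `a₁, …, a_n ∈ A₊`
with `d = deg a₁ > ⋯ > deg a_n ≥ 0`; a monic polynomial of degree `e` is encoded by its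
tuple of lower coefficients `c : Fin e → Fq`. -/
def Sd (d : ℤ) (A : PArr (Fb Fq)) : Kinf Fq :=
  ∑' e : {f : Fin A.depth → ℕ // StrictAnti f ∧ ∀ i : Fin A.depth, i.val = 0 → (f i : ℤ) = d},
    ∑ c : (∀ i, Fin (e.1 i) → Fq),
      ∏ i, cst Fq (A.eps i ^ e.1 i) / monicVal Fq (e.1 i) (c i) ^ A.s i

/-- The `N`-th cyclotomic multiple zeta value `ζ_A(𝛆;𝔰) = Σ_{d ≥ 0} S_d(𝛆;𝔰)`. -/
def zetaA (A : PArr (Fb Fq)) : Kinf Fq := ∑' d : ℕ, Sd Fq (d : ℤ) A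

/-- The cyclotomic field `k_N = 𝔽_q(ζ_N) ⊆ 𝔽̄_q`. -/
def kN (N : ℕ) : Subfield (Fb Fq) :=
  Subfield.closure (Set.range (algebraMap Fq (Fb Fq)) ∪ {x | x ^ N = 1})

/-- The field `K_N = k_N(θ)`, as a subfield of `𝔽̄_q((1/θ))`. -/
def KNf (N : ℕ) : Subfield (Kinf Fq) :=
  Subfield.closure ((cst Fq '' (kN Fq N : Set (Fb Fq))) ∪ {theta Fq})

/-- The ring `A_N = k_N[θ]`, as a subring of `𝔽̄_q((1/θ))`. -/
def AN (N : ℕ) : Subring (Kinf Fq) :=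
  Subring.closure ((cst Fq '' (kN Fq N : Set (Fb Fq))) ∪ {theta Fq})

/-- `CZ_{N,w}`: the `K_N`-span of the `N`-th cyclotomic multiple zeta values of weight `w`. -/
def CZ (N w : ℕ) : Submodule (KNf Fq N) (Kinf Fq) :=
  Submodule.span (KNf Fq N) {x | ∃ A : PArr (Fb Fq), A.Positive N ∧ A.wt = w ∧ x = zetaA Fq A}

/-- `CL_{N,w}`: the `K_N`-span of the CMPL's at `N`-th roots of unity of weight `w`. -/
def CL (N w : ℕ) : Submodule (KNf Fq N) (Kinf Fq) :=
  Submodule.span (KNf Fq N) {x | ∃ A : PArr (Fb Fq), A.Positive N ∧ A.wt = w ∧ x = Li Fq A}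

/-- The index set of pairs `(𝔰,𝛆)` with `𝔰 ∈ S_w` and `𝛆 ∈ Γ_N^{depth 𝔰}`: positive arrays
of weight `w` with `q ∤ sᵢ` for all `i`. -/
def SwIdx (N w : ℕ) : Type :=
  {A : PArr (Fb Fq) // A.Positive N ∧ 0 < A.depth ∧ A.wt = w ∧ ∀ i, ¬ qc Fq ∣ A.s i}

/-- The *type 1* array `(𝛆';𝔰')` associated with `(𝛆;𝔰)`, a pivot position `p`
(`0`-indexed, so `p = k - 1`) and `ε ∈ Γ_N`:
`𝔰' = (s₁, …, s_{k-1}, q, s_k - q, s_{k+1}, …, s_n)` and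
`𝛆' = (ε₁, …, ε_{k-1}, ε, ε⁻¹ε_k, ε_{k+1}, …, ε_n)`. -/
def typeOne (A : PArr (Fb Fq)) (p : Fin A.depth) (ε : Fb Fq) : PArr (Fb Fq) :=
  ⟨A.depth + 1,
    Fin.insertNth p.castSucc (qc Fq) (Function.update A.s p (A.s p - qc Fq)),
    Fin.insertNth p.castSucc ε (Function.update A.eps p (ε⁻¹ * A.eps p))⟩

/-- The length of the initial tuple `Init(𝔰)`: the largest `i` such that `s_j ≤ q` for
all `j ≤ i`. -/
def initLen {F : Type} (Q : ℕ) (A : PArr F) : ℕ :=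
  sInf ({i | ∃ h : i < A.depth, Q < A.s ⟨i, h⟩} ∪ {A.depth})

/-- `Init(𝔰) ≺ Init(𝔱)`: the strict lexicographic order on initial tuples. -/
def initLex {F : Type} (Q : ℕ) (A B : PArr F) : Prop :=
  ∃ j, j ≤ initLen Q A ∧ j ≤ initLen Q B ∧ (∀ i < j, A.sAt i = B.sAt i) ∧
    ((j = initLen Q A ∧ j < initLen Q B) ∨
      (j < initLen Q A ∧ j < initLen Q B ∧ A.sAt j < B.sAt j))

set_option synthInstance.maxHeartbeats 1000000


set_option linter.unusedSectionVars false

/-! ### Topology -/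

section gen
variable {K : Type*} [Field K] [Valued K (WithZero (Multiplicative ℤ))]

lemma gen_nonarch : NonarchimedeanAddGroup K where
  is_nonarchimedean := by
    intro U hU
    obtain ⟨γ, hγ⟩ := Valued.mem_nhds_zero.mp hU
    refine ⟨⟨Valuation.ltAddSubgroup (Valued.v (R := K)).restrict γ, ?_⟩, hγ⟩
    exact Valued.isOpen_ball K γ.1

lemma gen_summable [CompleteSpace K] {ι : Type*} (f : ι → K) (g : ι → ℕ)
    (hb : ∀ i, Valued.v (f i) ≤ WithZero.exp (-(g i : ℤ)))
    (hfin : ∀ M, {i | g i < M}.Finite) : Summable f := by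
  have : NonarchimedeanAddGroup K := gen_nonarch
  apply NonarchimedeanAddGroup.summable_of_tendsto_cofinite_zero
  intro U hU
  obtain ⟨γ, hγ⟩ := Valued.mem_nhds_zero.mp hU
  rw [Filter.mem_map, Filter.mem_cofinite]
  set δ := MonoidWithZeroHom.ValueGroup₀.embedding γ.1 with hδ
  have hδ0 : δ ≠ 0 := by simp [hδ]
  refine (hfin (Int.toNat (-(WithZero.log δ)) + 1)).subset ?_
  intro i hi
  by_contra hlt
  apply hi
  apply hγ
  change (Valued.v (R := K)).restrict (f i) < γ.1
  rw [Valuation.restrict_lt_iff_lt_embedding]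
  refine (hb i).trans_lt ?_
  rw [← hδ, ← WithZero.lt_log_iff_exp_lt hδ0]
  simp only [Set.mem_ofPred_eq, not_lt] at hlt
  omega

lemma gen_fac (a b : K) (n d : ℕ) (hn : 0 < n) (ha : Valued.v a ≤ 1)
    (hb : WithZero.exp (d : ℤ) ≤ Valued.v b) :
    Valued.v (a / b ^ n) ≤ WithZero.exp (-(d : ℤ)) := by
  rw [div_eq_mul_inv, map_mul, map_inv₀, map_pow]
  refine (mul_le_mul' ha le_rfl).trans ?_
  rw [one_mul, WithZero.exp_neg]
  have h1 : (1 : WithZero (Multiplicative ℤ)) ≤ Valued.v b :=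
    le_trans (by rw [← WithZero.exp_zero, WithZero.exp_le_exp]; positivity) hb
  have h2 : WithZero.exp (d : ℤ) ≤ Valued.v b ^ n :=
    hb.trans (le_self_pow₀ h1 (by omega))
  exact inv_anti₀ (by exact WithZero.exp_pos) h2

lemma gen_exp_sum {ι : Type*} (s : Finset ι) (f : ι → ℤ) :
    (WithZero.exp (∑ i ∈ s, f i) : WithZero (Multiplicative ℤ)) = ∏ i ∈ s, WithZero.exp (f i) := by
  induction s using Finset.induction_on with
  | empty => simp
  | insert a s ha ih => rw [Finset.sum_insert ha, Finset.prod_insert ha, WithZero.exp_add, ih]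

lemma gen_prod {ι : Type*} (s : Finset ι) (f : ι → K) (d : ι → ℕ)
    (h : ∀ i, Valued.v (f i) ≤ WithZero.exp (-(d i : ℤ))) :
    Valued.v (∏ i ∈ s, f i) ≤ WithZero.exp (-((∑ i ∈ s, d i : ℕ) : ℤ)) := by
  rw [map_prod]
  push_cast
  rw [← Finset.sum_neg_distrib, gen_exp_sum]
  exact Finset.prod_le_prod' fun i _ => h i

end gen

lemma two_le_qc : 2 ≤ qc Fq := Fintype.one_lt_card

lemma v_theta_pow (m : ℕ) : Valued.v (theta Fq ^ m) = WithZero.exp (m : ℤ) := by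
  have : Valued.v (theta Fq) = WithZero.exp (1 : ℤ) := by
    have h := LaurentSeries.valuation_single_zpow (Fb Fq) (-1)
    simpa [theta] using h
  rw [map_pow, this, ← WithZero.exp_nsmul]
  simp

lemma v_theta_sub (i : ℕ) (hi : 1 ≤ i) :
    Valued.v (theta Fq - theta Fq ^ qc Fq ^ i) = WithZero.exp ((qc Fq ^ i : ℕ) : ℤ) := by
  have h1 : 1 < qc Fq ^ i := Nat.one_lt_pow (by omega) (two_le_qc Fq)
  have h := Valuation.map_sub_eq_of_lt_right (Valued.v : Valuation (Kinf Fq) _)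
    (x := theta Fq ^ 1) (y := theta Fq ^ qc Fq ^ i) (by
      rw [v_theta_pow, v_theta_pow, WithZero.exp_lt_exp]; exact_mod_cast h1)
  rw [pow_one, v_theta_pow] at h
  exact h

lemma theta_sub_ne (i : ℕ) (hi : 1 ≤ i) : theta Fq - theta Fq ^ qc Fq ^ i ≠ 0 := by
  intro h
  have h2 := v_theta_sub Fq i hi
  rw [h, map_zero] at h2
  exact WithZero.exp_ne_zero h2.symm

lemma ell_zero : ell Fq 0 = 1 := by simp [ell]

lemma ell_succ (d : ℕ) : ell Fq (d + 1) = ell Fq d * (theta Fq - theta Fq ^ qc Fq ^ (d + 1)) := by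
  simp only [ell]
  rw [Finset.prod_Icc_succ_top (by omega)]

lemma ell_ne (d : ℕ) : ell Fq d ≠ 0 := by
  induction d with
  | zero => simp [ell_zero]
  | succ d ih => rw [ell_succ]; exact mul_ne_zero ih (theta_sub_ne Fq _ (by omega))

lemma v_ell (d : ℕ) : WithZero.exp (d : ℤ) ≤ Valued.v (ell Fq d) := by
  induction d with
  | zero => simp [ell_zero]
  | succ d ih =>
    rw [ell_succ, map_mul, v_theta_sub Fq _ (by omega)]
    push_cast
    rw [WithZero.exp_add]
    refine mul_le_mul' ih ?_
    rw [WithZero.exp_le_exp]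
    exact_mod_cast Nat.one_le_pow _ _ (by have := two_le_qc Fq; omega)

lemma v_cst (x : Fb Fq) : Valued.v (cst Fq x) ≤ 1 := by
  rw [LaurentSeries.val_le_one_iff_eq_coe]
  exact ⟨PowerSeries.C x, by simp [cst]⟩

/-- one factor -/
def fac (x : ℕ × Fb Fq) (d : ℕ) : Kinf Fq := cst Fq (x.2 ^ d) / ell Fq d ^ x.1

lemma v_fac (x : ℕ × Fb Fq) (hx : 0 < x.1) (d : ℕ) :
    Valued.v (fac Fq x d) ≤ WithZero.exp (-(d : ℤ)) :=
  gen_fac _ _ _ _ hx (v_cst Fq _) (v_ell Fq d)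

lemma summable_Li (A : PArr (Fb Fq)) (hA : ∀ i, 0 < A.s i) :
    Summable (fun d : {f : Fin A.depth → ℕ // StrictAnti f} =>
      ∏ i, fac Fq (A.s i, A.eps i) (d.1 i)) := by
  refine gen_summable _ (fun d => ∑ i, d.1 i)
    (fun d => gen_prod _ _ _ fun i => v_fac Fq (A.s i, A.eps i) (hA i) (d.1 i)) ?_
  intro M
  have hf : (Set.univ.pi (fun _ : Fin A.depth => Set.Iio M)).Finite :=
    Set.Finite.pi' (fun _ => Set.finite_Iio M) |>.subset (fun f hf i => hf i trivial)
  refine Set.Finite.of_finite_image (f := Subtype.val) (hf.subset ?_) Subtype.val_injective.injOn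
  rintro _ ⟨d, hd, rfl⟩ i -
  exact lt_of_le_of_lt (Finset.single_le_sum (f := d.1) (fun _ _ => Nat.zero_le _) (Finset.mem_univ i)) hd

lemma Li_def (A : PArr (Fb Fq)) : Li Fq A = ∑' d : {f : Fin A.depth → ℕ // StrictAnti f},
      ∏ i, fac Fq (A.s i, A.eps i) (d.1 i) := rfl


/-! ### Lists -/

abbrev Wd := List (ℕ × Fb Fq)

def ofList (L : Wd Fq) : PArr (Fb Fq) :=
  ⟨L.length, fun i => (L.get i).1, fun i => (L.get i).2⟩

def Slt : Wd Fq → ℕ → Kinf Fq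
  | [], _ => 1
  | x :: L, e => ∑ d ∈ Finset.range e, fac Fq x d * Slt L d

lemma Slt_cons_succ (x : ℕ × Fb Fq) (L : Wd Fq) (e : ℕ) :
    Slt Fq (x :: L) (e + 1) = Slt Fq (x :: L) e + fac Fq x e * Slt Fq L e := by
  simp only [Slt, Finset.sum_range_succ]

lemma Slt_cons_zero (x : ℕ × Fb Fq) (L : Wd Fq) : Slt Fq (x :: L) 0 = 0 := by
  simp [Slt]

def SAset (n e : ℕ) : Finset (Fin n → ℕ) :=
  (Fintype.piFinset (fun _ : Fin n => Finset.range e)).filter StrictAnti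

lemma mem_SAset (n e : ℕ) (f : Fin n → ℕ) :
    f ∈ SAset n e ↔ (∀ i, f i < e) ∧ StrictAnti f := by
  simp [SAset]

lemma Slt_eq (L : Wd Fq) (e : ℕ) :
    Slt Fq L e = ∑ f ∈ SAset L.length e, ∏ i, fac Fq (L.get i) (f i) := by
  induction L generalizing e with
  | nil =>
    have : SAset 0 e = {fun i => i.elim0} := by
      ext f
      simp only [mem_SAset, Finset.mem_singleton]
      constructor
      · intro _; funext i; exact i.elim0
      · intro _; exact ⟨fun i => i.elim0, fun i => i.elim0⟩
    simp [Slt, this]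
  | cons x L ih =>
    simp only [Slt, ih, Finset.mul_sum]
    rw [Finset.sum_sigma']
    refine Finset.sum_bij' (fun p _ => (Fin.cons p.1 p.2 : Fin (L.length + 1) → ℕ))
      (fun f _ => (⟨f 0, Fin.tail f⟩ : Σ _ : ℕ, Fin L.length → ℕ)) ?_ ?_ ?_ ?_ ?_
    · rintro ⟨d, f⟩ h
      simp only [Finset.mem_sigma, Finset.mem_range, mem_SAset] at h
      obtain ⟨h1, h2, h3⟩ := h
      refine (mem_SAset _ _ _).2 ⟨?_, ?_⟩
      · intro i
        refine Fin.cases ?_ (fun i => ?_) i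
        · simpa using h1
        · simpa using (h2 i).trans h1
      · intro i j hij
        induction j using Fin.cases with
        | zero => exact absurd hij (Fin.not_lt_zero _)
        | succ j =>
          induction i using Fin.cases with
          | zero => simpa using h2 j
          | succ i => simpa using h3 (Fin.succ_lt_succ_iff.1 hij)
    · intro f h
      obtain ⟨h1, h2⟩ := (mem_SAset _ _ _).1 h
      simp only [Finset.mem_sigma, Finset.mem_range, mem_SAset]
      refine ⟨h1 _, fun i => h2 (Fin.succ_pos i), fun i j hij => h2 (Fin.succ_lt_succ_iff.2 hij)⟩
    · rintro ⟨d, f⟩ h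
      simp
    · intro f h
      simp
    · rintro ⟨d, f⟩ h
      erw [Fin.prod_univ_succ]
      simp

lemma tendsto_Slt (L : Wd Fq) (hL : ∀ x ∈ L, 0 < x.1) :
    Filter.Tendsto (Slt Fq L) Filter.atTop (nhds (Li Fq (ofList Fq L))) := by
  have hs := (summable_Li Fq (ofList Fq L) (fun i => hL _ (List.get_mem L i))).hasSum
  rw [← Li_def] at hs
  have ht : Filter.Tendsto (fun e => (SAset L.length e).subtype StrictAnti)
      Filter.atTop Filter.atTop := by
    apply Filter.tendsto_atTop_finset_of_monotone
    · intro a b hab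
      apply Finset.subtype_mono
      intro f hf
      rw [mem_SAset] at hf ⊢
      exact ⟨fun i => (hf.1 i).trans_le hab, hf.2⟩
    · intro f
      refine ⟨∑ i, f.1 i + 1, ?_⟩
      rw [Finset.mem_subtype, mem_SAset]
      refine ⟨fun i => ?_, f.2⟩
      have := Finset.single_le_sum (f := f.1) (fun _ _ => Nat.zero_le _) (Finset.mem_univ i)
      omega
  have h := hs.comp ht
  refine h.congr fun e => ?_
  rw [Slt_eq]
  change (∑ d ∈ (SAset L.length e).subtype StrictAnti, ∏ i, fac Fq (L.get i) (d.1 i)) = _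
  rw [Finset.sum_subtype_eq_sum_filter (f := fun d : Fin L.length → ℕ => ∏ i, fac Fq (L.get i) (d i)),
    Finset.filter_true_of_mem (fun f hf => ((mem_SAset _ _ _).1 hf).2)]

lemma PArr_ext {F : Type} (A B : PArr F) (h : A.depth = B.depth)
    (hs : ∀ i (h1 : i < A.depth) (h2 : i < B.depth), A.s ⟨i, h1⟩ = B.s ⟨i, h2⟩)
    (he : ∀ i (h1 : i < A.depth) (h2 : i < B.depth), A.eps ⟨i, h1⟩ = B.eps ⟨i, h2⟩) : A = B := by
  obtain ⟨n, s, e⟩ := A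
  obtain ⟨m, s', e'⟩ := B
  dsimp only at h
  subst h
  congr
  · funext i; exact hs i.1 i.2 i.2
  · funext i; exact he i.1 i.2 i.2

lemma exists_ofList (A : PArr (Fb Fq)) : ∃ L, ofList Fq L = A := by
  refine ⟨List.ofFn fun i => (A.s i, A.eps i), PArr_ext _ _ (by simp [ofList]) ?_ ?_⟩ <;>
  · intro i h1 h2
    simp [ofList]

lemma sAt_ofList (L : Wd Fq) (i : ℕ) :
    (ofList Fq L).sAt i = (L.map Prod.fst)[i]?.getD 0 := by
  unfold PArr.sAt
  split_ifs with h
  · have h' : i < L.length := h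
    simp [ofList, h']
  · have h' : L.length ≤ i := not_lt.1 h
    simp [h']

def ps (L : Wd Fq) (l : ℕ) : ℕ := ((L.map Prod.fst).take l).sum
def wL (L : Wd Fq) : ℕ := (L.map Prod.fst).sum

lemma psum_ofList (L : Wd Fq) (l : ℕ) : (ofList Fq L).psum l = ps Fq L l := by
  unfold PArr.psum ps
  simp only [sAt_ofList]
  induction l with
  | zero => simp
  | succ l ih =>
    rw [Finset.sum_range_succ, ih, List.take_add_one, List.sum_append]
    congr 1
    cases (L.map Prod.fst)[l]? <;> simp

lemma wt_ofList (L : Wd Fq) : (ofList Fq L).wt = wL Fq L := by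
  unfold PArr.wt wL
  rw [← List.sum_ofFn]
  congr 1
  apply List.ext_getElem <;> simp [ofList]


/-! ### Relations -/

lemma fac_mul (a b : ℕ) (x y : Fb Fq) (d : ℕ) :
    fac Fq (a, x) d * fac Fq (b, y) d = fac Fq (a + b, x * y) d := by
  simp only [fac]
  rw [mul_pow, map_mul, pow_add, div_mul_div_comm]

def D1 : Kinf Fq := theta Fq ^ qc Fq - theta Fq

lemma frob_sub (a b : Kinf Fq) : (a - b) ^ qc Fq = a ^ qc Fq - b ^ qc Fq := by
  obtain ⟨p, hp⟩ := CharP.exists Fq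
  obtain ⟨n, hpr, hn⟩ := FiniteField.card Fq p
  have : Fact p.Prime := ⟨hpr⟩
  have h1 : CharP (Fb Fq) p := charP_of_injective_algebraMap (algebraMap Fq (Fb Fq)).injective p
  have h2 : CharP (Kinf Fq) p := charP_of_injective_ringHom (cst Fq).injective p
  rw [show qc Fq = p ^ (n : ℕ) from hn]
  exact sub_pow_expChar_pow a b _

lemma ell_one : ell Fq 1 = - D1 Fq := by
  rw [ell_succ, ell_zero, D1]; simp

lemma gen_step {K : Type*} [Field K] (X l1 ld t t' l' : K) (q : ℕ) (hq : 1 ≤ q)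
    (hl : l' ≠ 0) (hl' : l' = ld * t) (h : X * (l1 * ld ^ q) = l') (ht : t ^ q + l1 = t') :
    (X + 1 / l' ^ (q - 1)) * (l1 * l' ^ q) = l' * t' := by
  obtain ⟨m, rfl⟩ : ∃ m, q = m + 1 := ⟨q - 1, by omega⟩
  simp only [Nat.add_sub_cancel]
  have h3 : 1 / l' ^ m * (l1 * l' ^ (m + 1)) = l1 * l' := by
    field_simp; ring
  rw [add_mul, h3, ← ht]
  have : X * (l1 * l' ^ (m + 1)) = l' * t ^ (m + 1) := by
    conv_lhs => rw [hl', mul_pow]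
    rw [← h]; ring
  rw [this]; ring

lemma Slt_q (d : ℕ) :
    Slt Fq [(qc Fq - 1, 1)] (d + 1) * (ell Fq 1 * ell Fq d ^ qc Fq) = ell Fq (d + 1) := by
  induction d with
  | zero => simp [Slt, fac, ell_zero]
  | succ d ih =>
    rw [Slt_cons_succ, ell_succ Fq (d + 1)]
    have hf : fac Fq (qc Fq - 1, 1) (d + 1) * Slt Fq [] (d + 1)
        = 1 / ell Fq (d + 1) ^ (qc Fq - 1) := by simp [fac, Slt]
    rw [hf]
    refine gen_step _ _ (ell Fq d) (theta Fq - theta Fq ^ qc Fq ^ (d + 1)) _ _ _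
      (by have := two_le_qc Fq; omega) (ell_ne Fq _) (ell_succ Fq d) ih ?_
    rw [frob_sub, ← pow_mul, ← pow_succ, ell_succ, ell_zero]
    simp

lemma gen_base {K : Type*} [Field K] (S l1 ld l' a b D : K) (q : ℕ) (hl1 : l1 ≠ 0) (hld : ld ≠ 0)
    (hl : l' ≠ 0) (hD : l1 = -D) (ha : b * a = 1) (c : K)
    (h : S * (l1 * ld ^ q) = l') :
    c / ld ^ q = D * (-b) * ((c * a) / l' ^ 1) * S := by
  have hS : S = l' / (l1 * ld ^ q) := by
    rw [eq_div_iff]; exact h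
    positivity
  have hD' : D = - l1 := by rw [hD, neg_neg]
  rw [hS, hD']
  field_simp
  linear_combination (-1) * c * ha

lemma fac_base (ε : Fb Fq) (hε : ε ≠ 0) (d : ℕ) :
    fac Fq (qc Fq, ε) d =
      D1 Fq * (- cst Fq ε⁻¹) * fac Fq (1, ε) (d + 1) * Slt Fq [(qc Fq - 1, 1)] (d + 1) := by
  have h := gen_base (Slt Fq [(qc Fq - 1, 1)] (d + 1)) (ell Fq 1) (ell Fq d) (ell Fq (d + 1))
    (cst Fq ε) (cst Fq ε⁻¹) (D1 Fq) (qc Fq) (ell_ne Fq _) (ell_ne Fq _) (ell_ne Fq _)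
    (ell_one Fq) (by rw [← map_mul, inv_mul_cancel₀ hε, map_one]) (cst Fq (ε ^ d)) (Slt_q Fq d)
  simp only [fac]
  rw [pow_succ ε d, map_mul]
  exact h

def stf (x : ℕ × Fb Fq) : Wd Fq → List (Wd Fq)
  | [] => [[x]]
  | y :: L => (x :: y :: L) :: ((x.1 + y.1, x.2 * y.2) :: L) :: (stf x L).map (fun z => y :: z)

lemma sum_map_cons_succ (l : List (Wd Fq)) (y : ℕ × Fb Fq) (e : ℕ) :
    (l.map fun z => Slt Fq (y :: z) (e + 1)).sum =
      (l.map fun z => Slt Fq (y :: z) e).sum + fac Fq y e * (l.map fun z => Slt Fq z e).sum := by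
  simp only [Slt_cons_succ]
  rw [List.sum_map_add, List.sum_map_mul_left]

lemma sum_map_cons_zero (l : List (Wd Fq)) (y : ℕ × Fb Fq) :
    (l.map fun z => Slt Fq (y :: z) 0).sum = 0 := by
  simp [Slt_cons_zero]

lemma Slt_stf (x : ℕ × Fb Fq) (L : Wd Fq) (e : ℕ) :
    ((stf Fq x L).map fun z => Slt Fq z e).sum = Slt Fq [x] e * Slt Fq L e := by
  induction L generalizing e with
  | nil => simp [stf, Slt]
  | cons y L ih =>
    simp only [stf, List.map_cons, List.sum_cons, List.map_map, Function.comp_def]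
    induction e with
    | zero => simp [Slt_cons_zero]
    | succ e ihe =>
      rw [sum_map_cons_succ, ih]
      simp only [Slt_cons_succ _ x, Slt_cons_succ _ y, Slt_cons_succ _ (x.1 + y.1, x.2 * y.2)]
      rw [← fac_mul]
      have h1 : Slt Fq [] e = 1 := rfl
      rw [h1]
      linear_combination ihe

lemma base_rel (s : ℕ) (e : Fb Fq) (Q : Wd Fq) (hs : qc Fq ≤ s) (ε : Fb Fq) (hε : ε ≠ 0) (E : ℕ) :
    Slt Fq ((s, e) :: Q) E + Slt Fq ((qc Fq, ε) :: (s - qc Fq, ε⁻¹ * e) :: Q) E =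
      D1 Fq * (- cst Fq ε⁻¹) * ((stf Fq (qc Fq - 1, 1) ((s - qc Fq, ε⁻¹ * e) :: Q)).map
        fun z => Slt Fq ((1, ε) :: z) (E + 1)).sum := by
  induction E with
  | zero =>
    rw [sum_map_cons_succ, sum_map_cons_zero, Slt_stf]
    simp [Slt_cons_zero]
  | succ E ih =>
    rw [sum_map_cons_succ, Slt_stf, Slt_cons_succ _ (s, e), Slt_cons_succ _ (qc Fq, ε),
      Slt_cons_succ _ (s - qc Fq, ε⁻¹ * e)]
    have h := fac_base Fq ε hε E
    have h2 := fac_mul Fq (qc Fq) (s - qc Fq) ε (ε⁻¹ * e) E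
    rw [mul_inv_cancel_left₀ hε, Nat.add_sub_cancel' hs] at h2
    rw [← h2, mul_add, mul_add]
    generalize D1 Fq * (- cst Fq ε⁻¹) = C at *
    generalize Slt Fq [(qc Fq - 1, 1)] (E + 1) = S at *
    linear_combination ih + (Slt Fq ((s - qc Fq, ε⁻¹ * e) :: Q) E
      + fac Fq (s - qc Fq, ε⁻¹ * e) E * Slt Fq Q E) * h

lemma snoc_rel (C : Kinf Fq) (p : ℕ × Fb Fq) (L1 L2 : Wd Fq) (ε : Fb Fq) (l : List (Wd Fq))
    (h : ∀ E, Slt Fq L1 E + Slt Fq L2 E = C * (l.map fun z => Slt Fq ((1, ε) :: z) (E + 1)).sum)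
    (E : ℕ) :
    Slt Fq (p :: L1) E + Slt Fq (p :: L2) E =
      C * ((l.map fun z => Slt Fq ((p.1 + 1, p.2 * ε) :: z) E).sum
        + (l.map fun z => Slt Fq (p :: (1, ε) :: z) E).sum) := by
  induction E with
  | zero => simp [Slt_cons_zero]
  | succ E ih =>
    have h4 := sum_map_cons_succ Fq (l.map fun z => (1, ε) :: z) p E
    simp only [List.map_map, Function.comp_def] at h4
    rw [sum_map_cons_succ, h4, Slt_cons_succ, Slt_cons_succ, ← fac_mul]
    have h5 := h E
    rw [sum_map_cons_succ] at h5
    linear_combination ih + fac Fq p E * h5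

lemma pre_rel (C : Kinf Fq) (P L1 L2 : Wd Fq) (l : List (Wd Fq))
    (h : ∀ E, Slt Fq L1 E + Slt Fq L2 E = C * (l.map fun z => Slt Fq z E).sum)
    (E : ℕ) :
    Slt Fq (P ++ L1) E + Slt Fq (P ++ L2) E = C * (l.map fun z => Slt Fq (P ++ z) E).sum := by
  induction P generalizing E with
  | nil => exact h E
  | cons p P ih =>
    induction E with
    | zero => simp [Slt_cons_zero]
    | succ E ihE =>
      have h4 := sum_map_cons_succ Fq (l.map fun z => P ++ z) p E
      simp only [List.map_map, Function.comp_def] at h4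
      simp only [List.cons_append] at *
      rw [h4, Slt_cons_succ, Slt_cons_succ]
      linear_combination ihE + fac Fq p E * ih E

def LiL (L : Wd Fq) : Kinf Fq := Li Fq (ofList Fq L)

def PosL (N : ℕ) (L : Wd Fq) : Prop := ∀ x ∈ L, 0 < x.1 ∧ x.2 ^ N = 1

lemma lim_rel (C : Kinf Fq) (L1 L2 : Wd Fq) (l : List (Wd Fq)) (g : ℕ)
    (h1 : ∀ x ∈ L1, 0 < x.1) (h2 : ∀ x ∈ L2, 0 < x.1) (h3 : ∀ z ∈ l, ∀ x ∈ z, 0 < x.1)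
    (h : ∀ E, Slt Fq L1 E + Slt Fq L2 E = C * (l.map fun z => Slt Fq z (E + g)).sum) :
    LiL Fq L1 + LiL Fq L2 = C * (l.map (LiL Fq)).sum := by
  have t1 := (tendsto_Slt Fq L1 h1).add (tendsto_Slt Fq L2 h2)
  have t3 : Filter.Tendsto (fun E => (l.map fun z => Slt Fq z (E + g)).sum) Filter.atTop
      (nhds (l.map (LiL Fq)).sum) := by
    apply tendsto_list_sum
    intro z hz
    exact (tendsto_Slt Fq z (h3 z hz)).comp (Filter.tendsto_add_atTop_nat g)
  have t4 := t3.const_mul C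
  refine tendsto_nhds_unique t1 (t4.congr fun E => (h E).symm)


/-! ### Combinatorics -/

lemma ps_zero (L : Wd Fq) : ps Fq L 0 = 0 := by simp [ps]

lemma ps_nil (l : ℕ) : ps Fq [] l = 0 := by simp [ps]

lemma ps_cons (x : ℕ × Fb Fq) (L : Wd Fq) (l : ℕ) :
    ps Fq (x :: L) (l + 1) = x.1 + ps Fq L l := by simp [ps]

lemma wL_cons (x : ℕ × Fb Fq) (L : Wd Fq) : wL Fq (x :: L) = x.1 + wL Fq L := by simp [wL]

lemma wL_append (P L : Wd Fq) : wL Fq (P ++ L) = wL Fq P + wL Fq L := by simp [wL]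

lemma ps_append (P L : Wd Fq) (l : ℕ) :
    ps Fq (P ++ L) (P.length + l) = wL Fq P + ps Fq L l := by
  induction P with
  | nil => simp [wL]
  | cons p P ih =>
    rw [List.cons_append, List.length_cons, show P.length + 1 + l = P.length + l + 1 by ring,
      ps_cons, ih, wL_cons]
    ring

lemma ps_le_succ (L : Wd Fq) (l : ℕ) : ps Fq L l ≤ ps Fq L (l + 1) := by
  induction L generalizing l with
  | nil => simp [ps_nil]
  | cons x L ih =>
    cases l with
    | zero => simp [ps_zero]
    | succ l => rw [ps_cons, ps_cons]; have := ih l; omega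

lemma ps_lt_succ (L : Wd Fq) (hL : ∀ x ∈ L, 0 < x.1) (l : ℕ) (hl : l < L.length) :
    ps Fq L l < ps Fq L (l + 1) := by
  induction L generalizing l with
  | nil => simp at hl
  | cons x L ih =>
    have h1 := hL x (by simp)
    cases l with
    | zero => rw [ps_zero, ps_cons]; omega
    | succ l =>
      rw [ps_cons, ps_cons]
      have := ih (fun y hy => hL y (by simp [hy])) l (by simpa using hl)
      omega

lemma stf_wL (x : ℕ × Fb Fq) (L z : Wd Fq) (hz : z ∈ stf Fq x L) :
    wL Fq z = x.1 + wL Fq L := by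
  induction L generalizing z with
  | nil => simp only [stf, List.mem_singleton] at hz; subst hz; simp [wL]
  | cons y L ih =>
    simp only [stf, List.mem_cons, List.mem_map] at hz
    rcases hz with rfl | rfl | ⟨w, hw, rfl⟩
    · simp [wL_cons]
    · simp [wL_cons, add_assoc]
    · rw [wL_cons, wL_cons, ih w hw]; omega

lemma stf_length (x : ℕ × Fb Fq) (L z : Wd Fq) (hz : z ∈ stf Fq x L) :
    L.length ≤ z.length := by
  induction L generalizing z with
  | nil => simp
  | cons y L ih =>
    simp only [stf, List.mem_cons, List.mem_map] at hz
    rcases hz with rfl | rfl | ⟨w, hw, rfl⟩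
    · simp
    · simp
    · have := ih w hw
      simpa using this

lemma stf_ps (x : ℕ × Fb Fq) (L z : Wd Fq) (hz : z ∈ stf Fq x L) (l : ℕ) :
    ps Fq z l ≤ x.1 + ps Fq L l := by
  induction L generalizing z l with
  | nil =>
    simp only [stf, List.mem_singleton] at hz; subst hz
    cases l with
    | zero => simp [ps_zero]
    | succ l => simp [ps_cons, ps_nil]
  | cons y L ih =>
    simp only [stf, List.mem_cons, List.mem_map] at hz
    cases l with
    | zero => simp [ps_zero]
    | succ l =>
      rcases hz with rfl | rfl | ⟨w, hw, rfl⟩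
      · rw [ps_cons]; have := ps_le_succ Fq (y :: L) l; omega
      · rw [ps_cons, ps_cons]; simp only; omega
      · rw [ps_cons, ps_cons]; have := ih w hw l; omega

lemma PosL_cons (N : ℕ) (x : ℕ × Fb Fq) (L : Wd Fq) :
    PosL Fq N (x :: L) ↔ (0 < x.1 ∧ x.2 ^ N = 1) ∧ PosL Fq N L := by simp [PosL]

lemma PosL_append (N : ℕ) (P L : Wd Fq) :
    PosL Fq N (P ++ L) ↔ PosL Fq N P ∧ PosL Fq N L := by
  simp only [PosL, List.mem_append]
  exact ⟨fun h => ⟨fun x hx => h x (.inl hx), fun x hx => h x (.inr hx)⟩,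
    fun h x hx => hx.elim (h.1 x) (h.2 x)⟩

lemma stf_pos (N : ℕ) (x : ℕ × Fb Fq) (hx : 0 < x.1 ∧ x.2 ^ N = 1) (L z : Wd Fq)
    (hL : PosL Fq N L) (hz : z ∈ stf Fq x L) : PosL Fq N z := by
  induction L generalizing z with
  | nil =>
    simp only [stf, List.mem_singleton] at hz; subst hz
    exact (PosL_cons _ _ _ _).2 ⟨hx, hL⟩
  | cons y L ih =>
    simp only [stf, List.mem_cons, List.mem_map] at hz
    have hy := (PosL_cons _ _ _ _).1 hL
    rcases hz with rfl | rfl | ⟨w, hw, rfl⟩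
    · exact (PosL_cons _ _ _ _).2 ⟨hx, hL⟩
    · refine (PosL_cons _ _ _ _).2 ⟨⟨?_, ?_⟩, hy.2⟩
      · simp only; omega
      · simp only; rw [mul_pow, hx.2, hy.1.2, one_mul]
    · exact (PosL_cons _ _ _ _).2 ⟨hy.1, ih w hy.2 hw⟩

def sA (L : Wd Fq) (i : ℕ) : ℕ := (L.map Prod.fst)[i]?.getD 0

lemma sA_append_lt (P L : Wd Fq) (i : ℕ) (hi : i < P.length) :
    sA Fq (P ++ L) i = sA Fq P i := by
  simp only [sA, List.map_append]
  rw [List.getElem?_append_left (by simpa using hi)]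

lemma sA_append_len (P L : Wd Fq) (x : ℕ × Fb Fq) : sA Fq (P ++ x :: L) P.length = x.1 := by
  simp [sA]

structure G1 (N : ℕ) (L : Wd Fq) (k : ℕ) (B : Wd Fq) : Prop where
  pos : PosL Fq N B
  wt : wL Fq B = wL Fq L
  len : L.length ≤ B.length
  le : ∀ l, k ≤ l → ps Fq B l ≤ ps Fq L l

structure G2 (N : ℕ) (L : Wd Fq) (k : ℕ) (B : Wd Fq) : Prop extends G1 Fq N L k B where
  lt : ∀ l, k ≤ l → l ≤ L.length → ps Fq B l < ps Fq L l

structure G3 (N : ℕ) (L : Wd Fq) (k : ℕ) (B : Wd Fq) : Prop extends G1 Fq N L k B where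
  lex : ∃ j, j + 1 < k ∧ (∀ i < j, sA Fq B i = sA Fq L i) ∧
    sA Fq B j = sA Fq L j + 1 ∧ sA Fq B j ≤ qc Fq

lemma G1.trans {N : ℕ} {L U B : Wd Fq} {k k' : ℕ} (hk : k' ≤ k) (h : G1 Fq N L k U)
    (h' : G1 Fq N U k' B) : G1 Fq N L k B :=
  ⟨h'.pos, h'.wt.trans h.wt, h.len.trans h'.len,
    fun l hl => (h'.le l (hk.trans hl)).trans (h.le l hl)⟩

lemma G2.trans {N : ℕ} {L U B : Wd Fq} {k k' : ℕ} (hk : k' ≤ k) (h : G1 Fq N L k U)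
    (h' : G2 Fq N U k' B) : G2 Fq N L k B :=
  ⟨G1.trans Fq hk h h'.toG1,
    fun l hl hl' => (h'.lt l (hk.trans hl) (hl'.trans h.len)).trans_le (h.le l hl)⟩

section cases
variable (N : ℕ) (P : Wd Fq) (s : ℕ) (e : Fb Fq) (Q : Wd Fq) (ε : Fb Fq)

lemma root_inv (hε : ε ^ N = 1) (he : e ^ N = 1) : (ε⁻¹ * e) ^ N = 1 := by
  rw [mul_pow, inv_pow, hε, he]; simp

lemma one_G2 (hε : ε ^ N = 1) (hs : qc Fq < s) (h : PosL Fq N (P ++ (s, e) :: Q)) :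
    G2 Fq N (P ++ (s, e) :: Q) (P.length + 1)
      (P ++ (qc Fq, ε) :: (s - qc Fq, ε⁻¹ * e) :: Q) := by
  have hq := two_le_qc Fq
  obtain ⟨hP, hh⟩ := (PosL_append _ _ _ _).1 h
  obtain ⟨⟨h1, h2⟩, hQ⟩ := (PosL_cons _ _ _ _).1 hh
  have key : ∀ m, ps Fq ((qc Fq, ε) :: (s - qc Fq, ε⁻¹ * e) :: Q) (m + 1) ≤
      ps Fq ((s, e) :: Q) (m + 1) ∧ (m < Q.length + 1 →
      ps Fq ((qc Fq, ε) :: (s - qc Fq, ε⁻¹ * e) :: Q) (m + 1) <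
      ps Fq ((s, e) :: Q) (m + 1)) := by
    intro m
    cases m with
    | zero => simp only [ps_cons, ps_zero]; omega
    | succ m =>
      simp only [ps_cons]
      have a := ps_le_succ Fq Q m
      have b := ps_lt_succ Fq Q (fun x hx => (hQ x hx).1) m
      refine ⟨by omega, fun hm => ?_⟩
      have := b (by omega)
      omega
  refine ⟨⟨?_, ?_, ?_, ?_⟩, ?_⟩
  · refine (PosL_append _ _ _ _).2 ⟨hP, (PosL_cons _ _ _ _).2 ⟨⟨by simp only; omega, hε⟩,
      (PosL_cons _ _ _ _).2 ⟨⟨by simp only; omega, root_inv Fq N e ε hε h2⟩, hQ⟩⟩⟩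
  · simp only [wL_append, wL_cons]; omega
  · simp
  · intro l hl
    obtain ⟨m, rfl⟩ : ∃ m, l = P.length + (m + 1) := ⟨l - P.length - 1, by omega⟩
    rw [ps_append, ps_append]
    have := (key m).1
    omega
  · intro l hl hl'
    obtain ⟨m, rfl⟩ : ∃ m, l = P.length + (m + 1) := ⟨l - P.length - 1, by omega⟩
    rw [ps_append, ps_append]
    simp only [List.length_append, List.length_cons] at hl'
    have := (key m).2 (by omega)
    omega

lemma two_G2 (hε : ε ^ N = 1) (hs : qc Fq < s) (h : PosL Fq N (P ++ (s, e) :: Q))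
    (z : Wd Fq) (hz : z ∈ stf Fq (qc Fq - 1, 1) ((s - qc Fq, ε⁻¹ * e) :: Q)) :
    G2 Fq N (P ++ (s, e) :: Q) (P.length + 1) (P ++ (1, ε) :: z) := by
  have hq := two_le_qc Fq
  obtain ⟨hP, hh⟩ := (PosL_append _ _ _ _).1 h
  obtain ⟨⟨h1, h2⟩, hQ⟩ := (PosL_cons _ _ _ _).1 hh
  have key : ∀ m, ps Fq ((1, ε) :: z) (m + 1) ≤
      ps Fq ((s, e) :: Q) (m + 1) ∧ (m < Q.length + 1 →
      ps Fq ((1, ε) :: z) (m + 1) < ps Fq ((s, e) :: Q) (m + 1)) := by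
    intro m
    cases m with
    | zero => simp only [ps_cons, ps_zero]; omega
    | succ m =>
      simp only [ps_cons]
      have a := ps_le_succ Fq Q m
      have b := ps_lt_succ Fq Q (fun x hx => (hQ x hx).1) m
      have c := stf_ps Fq _ _ _ hz (m + 1)
      simp only [ps_cons] at c
      refine ⟨by omega, fun hm => ?_⟩
      have := b (by omega)
      omega
  have hzp : PosL Fq N z := stf_pos Fq N _ ⟨by simp only; omega, one_pow _⟩ _ _
    ((PosL_cons _ _ _ _).2 ⟨⟨by simp only; omega, root_inv Fq N e ε hε h2⟩, hQ⟩) hz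
  refine ⟨⟨?_, ?_, ?_, ?_⟩, ?_⟩
  · refine (PosL_append _ _ _ _).2 ⟨hP, (PosL_cons _ _ _ _).2 ⟨⟨by simp only; omega, hε⟩, hzp⟩⟩
  · have c := stf_wL Fq _ _ _ hz
    simp only [wL_append, wL_cons] at c ⊢; omega
  · have c := stf_length Fq _ _ _ hz
    simp only [List.length_append, List.length_cons] at c ⊢; omega
  · intro l hl
    obtain ⟨m, rfl⟩ : ∃ m, l = P.length + (m + 1) := ⟨l - P.length - 1, by omega⟩
    rw [ps_append, ps_append]
    have := (key m).1
    omega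
  · intro l hl hl'
    obtain ⟨m, rfl⟩ : ∃ m, l = P.length + (m + 1) := ⟨l - P.length - 1, by omega⟩
    rw [ps_append, ps_append]
    simp only [List.length_append, List.length_cons] at hl'
    have := (key m).2 (by omega)
    omega

lemma three_G1 (p : ℕ × Fb Fq) (hε : ε ^ N = 1) (hs : qc Fq < s)
    (h : PosL Fq N (P ++ p :: (s, e) :: Q))
    (z : Wd Fq) (hz : z ∈ stf Fq (qc Fq - 1, 1) ((s - qc Fq, ε⁻¹ * e) :: Q)) :
    G1 Fq N (P ++ p :: (s, e) :: Q) (P.length + 2) (P ++ (p.1 + 1, p.2 * ε) :: z) := by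
  have hq := two_le_qc Fq
  obtain ⟨hP, hh'⟩ := (PosL_append _ _ _ _).1 h
  obtain ⟨⟨hp1, hp2⟩, hh⟩ := (PosL_cons _ _ _ _).1 hh'
  obtain ⟨⟨h1, h2⟩, hQ⟩ := (PosL_cons _ _ _ _).1 hh
  have hzp : PosL Fq N z := stf_pos Fq N _ ⟨by simp only; omega, one_pow _⟩ _ _
    ((PosL_cons _ _ _ _).2 ⟨⟨by simp only; omega, root_inv Fq N e ε hε h2⟩, hQ⟩) hz
  refine ⟨?_, ?_, ?_, ?_⟩
  · refine (PosL_append _ _ _ _).2 ⟨hP, (PosL_cons _ _ _ _).2 ⟨⟨by simp only; omega, ?_⟩, hzp⟩⟩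
    simp only; rw [mul_pow, hp2, hε, one_mul]
  · have c := stf_wL Fq _ _ _ hz
    simp only [wL_append, wL_cons] at c ⊢; omega
  · have c := stf_length Fq _ _ _ hz
    simp only [List.length_append, List.length_cons] at c ⊢; omega
  · intro l hl
    obtain ⟨m, rfl⟩ : ∃ m, l = P.length + (m + 1 + 1) := ⟨l - P.length - 2, by omega⟩
    rw [ps_append, ps_append]
    have c := stf_ps Fq _ _ _ hz (m + 1)
    simp only [ps_cons] at c ⊢
    omega

end cases

def gset (N : ℕ) (L : Wd Fq) (k : ℕ) : Set (Kinf Fq) :=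
  {y | ∃ B, G2 Fq N L k B ∧ y = D1 Fq * LiL Fq B} ∪ {y | ∃ B, G3 Fq N L k B ∧ y = D1 Fq * LiL Fq B}

lemma theta_mem (N : ℕ) : theta Fq ∈ AN Fq N := Subring.subset_closure (.inr rfl)

lemma D1_mem (N : ℕ) : D1 Fq ∈ AN Fq N :=
  sub_mem (pow_mem (theta_mem Fq N) _) (theta_mem Fq N)

lemma cst_mem (N : ℕ) (x : Fb Fq) (hx : x ^ N = 1) : cst Fq x ∈ AN Fq N :=
  Subring.subset_closure (.inl ⟨x, Subfield.subset_closure (.inr hx), rfl⟩)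

lemma smul_mem_span (N : ℕ) (G : Set (Kinf Fq)) (c y : Kinf Fq) (hc : c ∈ AN Fq N)
    (hy : y ∈ Submodule.span (AN Fq N) G) : c * y ∈ Submodule.span (AN Fq N) G :=
  Submodule.smul_mem _ (⟨c, hc⟩ : AN Fq N) hy

lemma sum_mem_span (N : ℕ) (G : Set (Kinf Fq)) (c : Kinf Fq) (hc : c ∈ AN Fq N)
    (l : List (Wd Fq)) (h : ∀ z ∈ l, D1 Fq * LiL Fq z ∈ Submodule.span (AN Fq N) G) :
    D1 Fq * c * (l.map (LiL Fq)).sum ∈ Submodule.span (AN Fq N) G := by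
  induction l with
  | nil => simp
  | cons z l ih =>
    rw [List.map_cons, List.sum_cons, mul_add]
    refine add_mem ?_ (ih fun w hw => h w (by simp [hw]))
    rw [mul_comm (D1 Fq) c, mul_assoc]
    exact smul_mem_span Fq N G c _ hc (h z (by simp))

theorem main_list (N : ℕ) (hN : 0 < N) (n : ℕ) : ∀ (P : Wd Fq) (s : ℕ) (e : Fb Fq) (Q : Wd Fq)
    (ε : Fb Fq), P.length = n → PosL Fq N (P ++ (s, e) :: Q) → ε ^ N = 1 → qc Fq < s →
    (∀ x ∈ P, x.1 ≤ qc Fq) →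
    LiL Fq (P ++ (s, e) :: Q) + LiL Fq (P ++ (qc Fq, ε) :: (s - qc Fq, ε⁻¹ * e) :: Q) ∈
      Submodule.span (AN Fq N) (gset Fq N (P ++ (s, e) :: Q) (P.length + 1)) := by
  induction n with
  | zero =>
    intro P s e Q ε hn hpos hε hs hP
    obtain rfl := List.eq_nil_of_length_eq_zero hn
    have hε0 : ε ≠ 0 := by rintro rfl; rw [zero_pow (by omega)] at hε; exact zero_ne_one hε
    have t1 := one_G2 Fq N [] s e Q ε hε hs hpos
    have t2 := two_G2 Fq N [] s e Q ε hε hs hpos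
    simp only [List.nil_append] at *
    have h := lim_rel Fq (D1 Fq * (- cst Fq ε⁻¹)) ((s, e) :: Q)
      ((qc Fq, ε) :: (s - qc Fq, ε⁻¹ * e) :: Q)
      ((stf Fq (qc Fq - 1, 1) ((s - qc Fq, ε⁻¹ * e) :: Q)).map fun z => (1, ε) :: z) 1
      (fun x hx => (hpos x hx).1) (fun x hx => (t1.pos x hx).1)
      (by
        intro w hw
        obtain ⟨z, hz, rfl⟩ := List.mem_map.1 hw
        exact fun x hx => ((t2 z hz).pos x hx).1)
      (by
        intro E
        rw [base_rel Fq s e Q hs.le ε hε0, List.map_map]; rfl)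
    rw [h]
    apply sum_mem_span
    · exact neg_mem (cst_mem Fq N _ (by rw [inv_pow, hε, inv_one]))
    · intro w hw
      obtain ⟨z, hz, rfl⟩ := List.mem_map.1 hw
      exact Submodule.subset_span (.inl ⟨_, t2 z hz, rfl⟩)
  | succ n ih =>
    intro P' s e Q ε hn hpos hε hs hP
    have hε0 : ε ≠ 0 := by rintro rfl; rw [zero_pow (by omega)] at hε; exact zero_ne_one hε
    have t1 := one_G2 Fq N P' s e Q ε hε hs hpos
    have t2 := two_G2 Fq N P' s e Q ε hε hs hpos
    obtain rfl | ⟨P, p, rfl⟩ := List.eq_nil_or_concat P'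
    · simp at hn
    simp only [List.concat_eq_append, List.append_assoc, List.singleton_append, List.length_append,
      List.length_cons, List.length_nil, zero_add] at hn hpos t1 t2 ⊢
    have t3 := three_G1 Fq N P s e Q ε p hε hs hpos
    have hPn : P.length = n := by omega
    have h := lim_rel Fq (D1 Fq * (- cst Fq ε⁻¹)) (P ++ p :: (s, e) :: Q)
      (P ++ p :: (qc Fq, ε) :: (s - qc Fq, ε⁻¹ * e) :: Q)
      (((stf Fq (qc Fq - 1, 1) ((s - qc Fq, ε⁻¹ * e) :: Q)).map
          fun z => P ++ (p.1 + 1, p.2 * ε) :: z) ++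
        ((stf Fq (qc Fq - 1, 1) ((s - qc Fq, ε⁻¹ * e) :: Q)).map
          fun z => P ++ p :: (1, ε) :: z)) 0
      (fun x hx => (hpos x hx).1) (fun x hx => (t1.pos x hx).1)
      (by
        intro w hw
        rcases List.mem_append.1 hw with hw | hw
        · obtain ⟨z, hz, rfl⟩ := List.mem_map.1 hw
          exact fun x hx => ((t3 z hz).pos x hx).1
        · obtain ⟨z, hz, rfl⟩ := List.mem_map.1 hw
          exact fun x hx => ((t2 z hz).pos x hx).1)
      (by
        intro E
        have h1 := snoc_rel Fq _ p _ _ ε _ (base_rel Fq s e Q hs.le ε hε0)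
        have h2 := pre_rel Fq _ P _ _
          (((stf Fq (qc Fq - 1, 1) ((s - qc Fq, ε⁻¹ * e) :: Q)).map
            fun z => (p.1 + 1, p.2 * ε) :: z) ++
          ((stf Fq (qc Fq - 1, 1) ((s - qc Fq, ε⁻¹ * e) :: Q)).map
            fun z => p :: (1, ε) :: z))
          (fun E => by
            rw [h1 E, List.map_append, List.sum_append, List.map_map, List.map_map]; rfl) E
        rw [h2]
        simp only [List.map_append, List.map_map]; rfl)
    rw [h]
    apply sum_mem_span
    · exact neg_mem (cst_mem Fq N _ (by rw [inv_pow, hε, inv_one]))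
    · intro w hw
      rcases List.mem_append.1 hw with hw | hw
      · obtain ⟨z, hz, rfl⟩ := List.mem_map.1 hw
        have g1 := t3 z hz
        have hpq : p.1 ≤ qc Fq := hP p (by simp)
        by_cases hlt : p.1 + 1 ≤ qc Fq
        · refine Submodule.subset_span (.inr ⟨_, ⟨g1, P.length, by omega, ?_, ?_, ?_⟩, rfl⟩)
          · intro i hi
            rw [sA_append_lt _ _ _ _ hi, sA_append_lt _ _ _ _ hi]
          · rw [sA_append_len, sA_append_len]
          · rw [sA_append_len]; exact hlt
        · have hi := ih P (p.1 + 1) (p.2 * ε) z 1 hPn g1.pos (one_pow _) (by omega)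
            (fun x hx => hP x (by simp [hx]))
          have o1 := one_G2 Fq N P (p.1 + 1) (p.2 * ε) z 1 (one_pow _) (by omega) g1.pos
          have hsub : gset Fq N (P ++ (p.1 + 1, p.2 * ε) :: z) (P.length + 1) ⊆
              gset Fq N (P ++ p :: (s, e) :: Q) (P.length + 1 + 1) := by
            rintro y (⟨B, hB, rfl⟩ | ⟨B, hB, rfl⟩)
            · exact .inl ⟨B, G2.trans Fq (by omega) g1 hB, rfl⟩
            · obtain ⟨j, hj, hj1, hj2, hj3⟩ := hB.lex
              refine .inr ⟨B, ⟨G1.trans Fq (by omega) g1 hB.toG1, j, by omega, ?_, ?_, hj3⟩, rfl⟩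
              · intro i hi
                rw [hj1 i hi, sA_append_lt _ _ _ _ (by omega), sA_append_lt _ _ _ _ (by omega)]
              · rw [hj2, sA_append_lt _ _ _ _ (by omega), sA_append_lt _ _ _ _ (by omega)]
          have hi2 := smul_mem_span Fq N _ (D1 Fq) _ (D1_mem Fq N) (Submodule.span_mono hsub hi)
          rw [mul_add] at hi2
          refine (Submodule.add_mem_iff_left _ ?_).1 hi2
          exact Submodule.subset_span (.inl ⟨_, G2.trans Fq (by omega) g1 o1, rfl⟩)
      · obtain ⟨z, hz, rfl⟩ := List.mem_map.1 hw
        exact Submodule.subset_span (.inl ⟨_, t2 z hz, rfl⟩)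


/-! ### Back to arrays -/

lemma insertNth_val {α : Type} {n : ℕ} (p : Fin n) (a : α) (f : Fin n → α) (i : ℕ) (h : i < n + 1) :
    (Fin.insertNth p.castSucc a f : Fin (n + 1) → α) ⟨i, h⟩ =
      if h1 : i < p.1 then f ⟨i, by omega⟩ else if h2 : i = p.1 then a else f ⟨i - 1, by omega⟩ := by
  split_ifs with h1 h2
  · have : (⟨i, h⟩ : Fin (n + 1)) = p.castSucc.succAbove ⟨i, by omega⟩ := by
      ext; simp [Fin.succAbove, Fin.lt_def, h1]
    rw [this, Fin.insertNth_apply_succAbove]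
  · have : (⟨i, h⟩ : Fin (n + 1)) = p.castSucc := by ext; simp [h2]
    rw [this, Fin.insertNth_apply_same]
  · have : (⟨i, h⟩ : Fin (n + 1)) = p.castSucc.succAbove ⟨i - 1, by omega⟩ := by
      have h3 : ¬ (i - 1 < p.1) := by omega
      ext; simp [Fin.succAbove, Fin.lt_def, h3]; omega
    rw [this, Fin.insertNth_apply_succAbove]

lemma insertNth_upd {α : Type} {n : ℕ} (p : Fin n) (a b : α) (f : Fin n → α) (i : ℕ)
    (h : i < n + 1) :
    (Fin.insertNth p.castSucc a (Function.update f p b) : Fin (n + 1) → α) ⟨i, h⟩ =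
      if h1 : i < p.1 then f ⟨i, by omega⟩ else if h2 : i = p.1 then a
        else if i = p.1 + 1 then b else f ⟨i - 1, by omega⟩ := by
  rw [insertNth_val]
  simp only [Function.update_apply, Fin.ext_iff]
  split_ifs <;> first | rfl | omega

lemma getElem_mid {α : Type} (P Q : List α) (x : α) (i : ℕ) (h : i < (P ++ x :: Q).length)
    (h1 : ¬ i < P.length) (h2 : i ≠ P.length) :
    (P ++ x :: Q)[i] = Q[i - P.length - 1]'(by simp at h; omega) := by
  rw [List.getElem_append_right (by omega)]
  rw [List.getElem_cons]
  rw [dif_neg (by omega)]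

lemma typeOne_ofList (P : Wd Fq) (s : ℕ) (e : Fb Fq) (Q : Wd Fq) (ε : Fb Fq)
    (h : P.length < (ofList Fq (P ++ (s, e) :: Q)).depth) :
    typeOne Fq (ofList Fq (P ++ (s, e) :: Q)) ⟨P.length, h⟩ ε =
      ofList Fq (P ++ (qc Fq, ε) :: (s - qc Fq, ε⁻¹ * e) :: Q) := by
  refine PArr_ext _ _ (by simp [typeOne, ofList]; omega) ?_ ?_ <;>
  · intro i h1 h2
    refine (insertNth_upd _ _ _ _ i h1).trans ?_
    simp only [ofList, List.get_eq_getElem]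
    split_ifs with a b c
    · rw [List.getElem_append_left a, List.getElem_append_left a]
    · subst b; simp
    · obtain rfl : i = P.length + 1 := by omega
      simp [List.getElem_append_right]
    · rw [getElem_mid _ _ _ _ _ (by omega) (by omega), getElem_mid _ _ _ _ _ (by omega) (by omega)]
      rw [List.getElem_cons, dif_neg (by omega)]
      congr 2
      omega

lemma le_initLen {F : Type} (Q m : ℕ) (A : PArr F) (hm : m ≤ A.depth)
    (h : ∀ i < m, A.sAt i ≤ Q) : m ≤ initLen Q A := by
  refine le_csInf ⟨A.depth, .inr rfl⟩ ?_
  rintro i (⟨hi, h2⟩ | rfl)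
  · by_contra hlt
    have := h i (by omega)
    rw [PArr.sAt, dif_pos hi] at this
    omega
  · exact hm

lemma Positive_ofList (N : ℕ) (L : Wd Fq) : (ofList Fq L).Positive N ↔ PosL Fq N L := by
  constructor
  · rintro ⟨h1, h2⟩ x hx
    obtain ⟨i, rfl⟩ := List.mem_iff_get.1 hx
    exact ⟨h1 i, h2 i⟩
  · intro h
    exact ⟨fun i => (h _ (List.get_mem L i)).1, fun i => (h _ (List.get_mem L i)).2⟩

lemma span_rep (N : ℕ) {G : Wd Fq → Prop} (x : Kinf Fq)
    (hx : x ∈ Submodule.span (AN Fq N) {y | ∃ B, G B ∧ y = D1 Fq * LiL Fq B}) :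
    ∃ (m : ℕ) (b : Fin m → Kinf Fq) (B : Fin m → Wd Fq),
      (∀ i, ∃ y ∈ AN Fq N, b i = D1 Fq * y) ∧ (∀ i, G (B i)) ∧
      x = ∑ i, b i * Li Fq (ofList Fq (B i)) := by
  obtain ⟨m, f, g, rfl⟩ := Submodule.mem_span_set'.1 hx
  choose B hB hg using fun i => (g i).2
  refine ⟨m, fun i => D1 Fq * (f i).1, B, fun i => ⟨_, (f i).2, rfl⟩, hB, ?_⟩
  refine Finset.sum_congr rfl fun i _ => ?_
  rw [hg i]
  change (f i).1 * (D1 Fq * LiL Fq (B i)) = _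
  rw [← mul_assoc, mul_comm (f i).1]; rfl

lemma G3_initLex (N : ℕ) (P : Wd Fq) (s : ℕ) (e : Fb Fq) (Q U : Wd Fq)
    (hP : ∀ x ∈ P, x.1 ≤ qc Fq)
    (h : G3 Fq N (P ++ (s, e) :: Q) (P.length + 1) U) :
    initLex (qc Fq) (ofList Fq (P ++ (s, e) :: Q)) (ofList Fq U) := by
  obtain ⟨j, hj, h1, h2, h3⟩ := h.lex
  have sAP : ∀ i < P.length, sA Fq (P ++ (s, e) :: Q) i ≤ qc Fq := by
    intro i hi
    rw [sA_append_lt _ _ _ _ hi]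
    simp only [sA, List.getElem?_map, List.getElem?_eq_getElem hi]
    exact hP _ (List.getElem_mem hi)
  have hA : P.length ≤ initLen (qc Fq) (ofList Fq (P ++ (s, e) :: Q)) := by
    apply le_initLen
    · simp [ofList]
    · intro i hi
      rw [sAt_ofList]; exact sAP i hi
  have hU : j + 1 ≤ initLen (qc Fq) (ofList Fq U) := by
    apply le_initLen
    · have := h.len
      simp only [List.length_append, List.length_cons] at this
      change j + 1 ≤ U.length
      omega
    · intro i hi
      rw [sAt_ofList]
      change sA Fq U i ≤ _
      rcases Nat.lt_succ_iff_lt_or_eq.1 hi with hi | rfl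
      · rw [h1 i hi]; exact sAP i (by omega)
      · exact h3
  refine ⟨j, by omega, by omega, ?_, .inr ⟨by omega, by omega, ?_⟩⟩
  · intro i hi
    rw [sAt_ofList, sAt_ofList]; exact (h1 i hi).symm
  · rw [sAt_ofList, sAt_ofList]
    change sA Fq _ j < sA Fq _ j
    omega

/-- **Key decomposition of CMPL's into types 1/2/3** (Proposition `polydecom`, part 1):
if `Init(𝔰) = (s₁,…,s_{k-1})` (i.e. `s_j ≤ q` for `j < k` and `s_k > q`) and `ε ∈ Γ_N`,
then `Li(𝛆;𝔰) = -Li(𝛆';𝔰') + Σ_i b_i·Li(𝛜'_i;𝔱'_i) + Σ_i c_i·Li(𝛍_i;𝔲_i)` with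
coefficients in `A_N` divisible by `D₁ = θ^q - θ` and the stated depth, `T_k`, partial
sum and `Init`-lexicographic constraints. -/
theorem key_decomposition_CMPL
    (Fq : Type) [Field Fq] [Fintype Fq] (N : ℕ) (hN : 0 < N)
    (A : PArr (Fb Fq)) (hA : A.Positive N)
    (k : ℕ) (hk1 : 1 ≤ k) (hk2 : k ≤ A.depth)
    (hinit : ∀ i : Fin A.depth, i.val < k - 1 → A.s i ≤ qc Fq)
    (hpivot : qc Fq < A.s ⟨k - 1, by omega⟩)
    (ε : Fb Fq) (hε : ε ^ N = 1) :
    ∃ (m₂ m₃ : ℕ) (b : Fin m₂ → Kinf Fq) (c : Fin m₃ → Kinf Fq)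
      (B : Fin m₂ → PArr (Fb Fq)) (U : Fin m₃ → PArr (Fb Fq)),
      -- the coefficients lie in `A_N` and are divisible by `D₁ = θ^q - θ`
      (∀ i, ∃ y ∈ AN Fq N, b i = (theta Fq ^ qc Fq - theta Fq) * y) ∧
      (∀ i, ∃ y ∈ AN Fq N, c i = (theta Fq ^ qc Fq - theta Fq) * y) ∧
      -- all the arrays on the right-hand side are positive of weight `w(𝔰)`
      (∀ i, (B i).Positive N ∧ (B i).wt = A.wt) ∧
      (∀ i, (U i).Positive N ∧ (U i).wt = A.wt) ∧
      -- the decomposition itself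
      Li Fq A
        = - Li Fq (typeOne Fq A ⟨k - 1, by omega⟩ ε)
          + ∑ i, b i * Li Fq (B i) + ∑ i, c i * Li Fq (U i) ∧
      -- every tuple `𝔱` on the right-hand side has `depth 𝔱 ≥ depth 𝔰` and
      -- `T_k(𝔱) ≤ T_k(𝔰)`, i.e. all its partial sums from position `k` on are dominated
      (A.depth ≤ (typeOne Fq A ⟨k - 1, by omega⟩ ε).depth ∧
        (typeOne Fq A ⟨k - 1, by omega⟩ ε).wt = A.wt ∧
        ∀ ℓ, k ≤ ℓ → (typeOne Fq A ⟨k - 1, by omega⟩ ε).psum ℓ ≤ A.psum ℓ) ∧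
      (∀ i, A.depth ≤ (B i).depth ∧ ∀ ℓ, k ≤ ℓ → (B i).psum ℓ ≤ A.psum ℓ) ∧
      (∀ i, A.depth ≤ (U i).depth ∧ ∀ ℓ, k ≤ ℓ → (U i).psum ℓ ≤ A.psum ℓ) ∧
      -- strict inequalities of partial sums for the type 1 array
      (∀ ℓ, k ≤ ℓ → ℓ ≤ A.depth →
        (typeOne Fq A ⟨k - 1, by omega⟩ ε).psum ℓ < A.psum ℓ) ∧
      -- strict inequalities of partial sums for the type 2 arrays
      (∀ i, ∀ ℓ, k ≤ ℓ → ℓ ≤ A.depth → (B i).psum ℓ < A.psum ℓ) ∧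
      -- `Init(𝔰) ≺ Init(𝔲)` for the type 3 arrays
      (∀ i, initLex (qc Fq) A (U i)) := by
  obtain ⟨L, rfl⟩ := exists_ofList Fq A
  obtain ⟨P, x, Q, rfl, hPk⟩ : ∃ P x Q, L = P ++ x :: Q ∧ P.length = k - 1 := by
    have hk : k - 1 < L.length := by have : k ≤ L.length := hk2; omega
    refine ⟨L.take (k - 1), L[k - 1], L.drop (k - 1 + 1), ?_, ?_⟩
    · rw [List.getElem_cons_drop, List.take_append_drop]
    · rw [List.length_take]; omega
  obtain ⟨s, e⟩ := x
  obtain rfl : k = P.length + 1 := by omega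
  simp only [Nat.add_sub_cancel] at *
  have hs : qc Fq < s := by simpa [ofList] using hpivot
  have hP : ∀ x ∈ P, x.1 ≤ qc Fq := by
    intro x hx
    obtain ⟨i, hi, rfl⟩ := List.mem_iff_getElem.1 hx
    have := hinit ⟨i, by simp [ofList]; omega⟩ hi
    simpa [ofList, List.getElem_append_left hi] using this
  rw [Positive_ofList] at hA
  rw [typeOne_ofList]
  have hm := main_list Fq N hN P.length P s e Q ε rfl hA hε hs hP
  have h1 := one_G2 Fq N P s e Q ε hε hs hA
  rw [gset, Submodule.span_union, Submodule.mem_sup] at hm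
  obtain ⟨y, hy, z, hz, hyz⟩ := hm
  obtain ⟨m₂, b, B, hb, hB, rfl⟩ := span_rep Fq N y hy
  obtain ⟨m₃, c, U, hc, hU, rfl⟩ := span_rep Fq N z hz
  refine ⟨m₂, m₃, b, c, fun i => ofList Fq (B i), fun i => ofList Fq (U i), hb, hc, ?_, ?_, ?_,
    ?_, ?_, ?_, ?_, ?_, ?_⟩
  · intro i
    rw [Positive_ofList, wt_ofList, wt_ofList]
    exact ⟨(hB i).pos, (hB i).wt⟩
  · intro i
    rw [Positive_ofList, wt_ofList, wt_ofList]
    exact ⟨(hU i).pos, (hU i).wt⟩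
  · simp only [LiL] at hyz
    rw [add_assoc, hyz]; ring
  · simp only [psum_ofList, wt_ofList]
    exact ⟨h1.len, h1.wt, h1.le⟩
  · simp only [psum_ofList]
    exact fun i => ⟨(hB i).len, (hB i).le⟩
  · simp only [psum_ofList]
    exact fun i => ⟨(hU i).len, (hU i).le⟩
  · simp only [psum_ofList]
    exact h1.lt
  · simp only [psum_ofList]
    exact fun i => (hB i).lt
  · exact fun i => G3_initLex Fq N P s e Q (U i) hP (hU i)

end ZHPC
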